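/- arXiv:2205.02004 — 2 statements merged into one kernel-verified Lean document; each statement's English description precedes it below -/
import Mathlib

section
/- Let G be a connected graph with minimum degree at least 2 that has at least two independent cycles (m > n). Then the algebraic multiplicity of λ = 1 as an eigenvalue of the non-backtracking matrix of G is exactly m − n + 1, where m is the number of edges and n the number of nodes. -/
open SimpleGraph Matrix

/-- The non-backtracking matrix of a simple graph, indexed by oriented edges (darts). -/
def nbMatrix {V : Type} [Fintype V] [DecidableEq V] (G : SimpleGraph V) [DecidableRel G.Adj] :
    Matrix G.Dart G.Dart ℂ :=
  fun d e => if e.toProd.2 = d.toProd.1 ∧ e.toProd.1 ≠ d.toProd.2 then 1 else 0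

namespace SimpleGraph

variable {V : Type} [Fintype V] [DecidableEq V] (G : SimpleGraph V) [DecidableRel G.Adj]

/-- The total weight of the darts ending at `v`. -/
def inflow (x : G.Dart → ℂ) (v : V) : ℂ := ∑ d : G.Dart, if d.snd = v then x d else 0

variable {G}

lemma sum_mul_snd (x : G.Dart → ℂ) (g : V → ℂ) :
    ∑ d : G.Dart, x d * g d.snd = ∑ v, G.inflow x v * g v := by
  simp only [inflow, Finset.sum_mul]
  rw [Finset.sum_comm]
  simp

omit [DecidableEq V] in
lemma sum_dart_symm (f : G.Dart → ℂ) : ∑ d : G.Dart, f d.symm = ∑ d : G.Dart, f d :=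
  Equiv.sum_comp (Dart.symm_involutive (G := G)).toPerm f

lemma nbMatrix_mulVec_apply (x : G.Dart → ℂ) (d : G.Dart) :
    (nbMatrix G *ᵥ x) d = G.inflow x d.fst - x d.symm := by
  have hx : x d.symm = ∑ e : G.Dart, if e = d.symm then x e else 0 := by simp
  rw [hx, inflow, ← Finset.sum_sub_distrib]
  refine Finset.sum_congr rfl fun e _ => ?_
  have he : e = d.symm ↔ e.snd = d.fst ∧ e.fst = d.snd := by
    rw [Dart.ext_iff, Prod.ext_iff]
    exact and_comm
  by_cases h1 : e.snd = d.fst <;> by_cases h2 : e.fst = d.snd <;>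
    simp [nbMatrix, he, h1, h2]

omit [Fintype V] [DecidableEq V] [DecidableRel G.Adj] in
lemma Connected.eq_of_forall_adj {α : Type*} (hconn : G.Connected) {g : V → α}
    (h : ∀ d : G.Dart, g d.fst = g d.snd) (u v : V) : g u = g v := by
  obtain ⟨p⟩ := hconn.preconnected u v
  induction p with
  | nil => rfl
  | cons hadj _ ih => exact (h ⟨(_, _), hadj⟩).trans ih

/-- The fixed vectors of the non-backtracking matrix are the circulations, i.e. the antisymmetric
functions on darts that are conserved at each node. -/
lemma nbMatrix_mulVec_eq_self_iff (hconn : G.Connected)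
    (hmn : Fintype.card V < G.edgeFinset.card) (x : G.Dart → ℂ) :
    nbMatrix G *ᵥ x = x ↔ (∀ d, x d.symm = -x d) ∧ ∀ v, G.inflow x v = 0 := by
  constructor
  · intro h
    have h' (d : G.Dart) : G.inflow x d.fst - x d.symm = x d := by
      rw [← nbMatrix_mulVec_apply, h]
    have hconst := hconn.eq_of_forall_adj (g := G.inflow x) fun d => by
      have h1 := h' d
      have h2 := h' d.symm
      rw [Dart.symm_symm] at h2
      change G.inflow x d.snd - x d = _ at h2
      linear_combination h1 - h2
    have hzero : ∀ v, G.inflow x v = 0 := by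
      intro v
      have h1 : ∑ d, x d = Fintype.card V * G.inflow x v := by
        have := sum_mul_snd x fun _ => 1
        simpa [hconst _ v] using this
      have h2 : ∑ d : G.Dart, x d.symm + ∑ d : G.Dart, x d = 2 * G.edgeFinset.card * G.inflow x v := by
        rw [← Finset.sum_add_distrib]
        trans ∑ _d : G.Dart, G.inflow x v
        · refine Finset.sum_congr rfl fun d _ => ?_
          rw [← h' d, hconst d.fst v]
          ring
        · simp [dart_card_eq_twice_card_edges]
      rw [sum_dart_symm, h1] at h2
      have h3 : ((Fintype.card V : ℂ) - G.edgeFinset.card) * G.inflow x v = 0 := by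
        linear_combination h2 / 2
      refine (mul_eq_zero.mp h3).resolve_left (sub_ne_zero.mpr ?_)
      exact_mod_cast hmn.ne
    exact ⟨fun d => by linear_combination hzero d.fst - h' d, hzero⟩
  · rintro ⟨h1, h2⟩
    ext d
    rw [nbMatrix_mulVec_apply, h1, h2]
    ring

open scoped ComplexOrder in
/-- A circulation that is a gradient vanishes. -/
lemma circulation_eq_zero_of_gradient {x : G.Dart → ℂ} (hanti : ∀ d, x d.symm = -x d)
    (hin : ∀ v, G.inflow x v = 0) {g : V → ℂ} (hg : ∀ d, x d = g d.fst - g d.snd) : x = 0 := by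
  have hsnd : ∑ d : G.Dart, x d * star (g d.snd) = 0 := by
    rw [sum_mul_snd x fun v => star (g v)]
    simp [hin]
  have hfst : ∑ d : G.Dart, x d * star (g d.fst) = 0 := by
    rw [← sum_dart_symm]
    have : ∀ d : G.Dart, x d.symm * star (g d.symm.fst) = -(x d * star (g d.snd)) := by
      intro d
      rw [hanti, neg_mul]
      rfl
    simp only [this, Finset.sum_neg_distrib, hsnd, neg_zero]
  rw [← dotProduct_self_star_eq_zero]
  calc x ⬝ᵥ star x = ∑ d : G.Dart, (x d * star (g d.fst) - x d * star (g d.snd)) := by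
        refine Finset.sum_congr rfl fun d _ => ?_
        rw [← mul_sub, ← star_sub, ← hg]
        rfl
    _ = 0 := by rw [Finset.sum_sub_distrib, hfst, hsnd, sub_zero]

lemma nbMatrix_mulVec_eq_self_of_sq (hconn : G.Connected)
    (hmn : Fintype.card V < G.edgeFinset.card) {y : G.Dart → ℂ}
    (h : nbMatrix G *ᵥ (nbMatrix G *ᵥ y - y) = nbMatrix G *ᵥ y - y) :
    nbMatrix G *ᵥ y = y := by
  obtain ⟨hanti, hin⟩ := (nbMatrix_mulVec_eq_self_iff hconn hmn _).mp h
  refine sub_eq_zero.mp (circulation_eq_zero_of_gradient hanti hin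
    (g := fun v => G.inflow y v / 2) fun d => ?_)
  have h1 := hanti d
  simp only [Pi.sub_apply, nbMatrix_mulVec_apply, Dart.symm_symm] at h1 ⊢
  change G.inflow y d.snd - y d - _ = _ at h1
  linear_combination h1 / 2

lemma maxGenEigenspace_nbMatrix_one (hconn : G.Connected)
    (hmn : Fintype.card V < G.edgeFinset.card) :
    Module.End.maxGenEigenspace (toLin' (nbMatrix G)) 1 = Module.End.eigenspace (toLin' (nbMatrix G)) 1 := by
  set f := toLin' (nbMatrix G) - (1 : ℂ) • (1 : Module.End ℂ (G.Dart → ℂ)) with hf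
  have happ (y) : f y = nbMatrix G *ᵥ y - y := by simp [hf]
  have hker : LinearMap.ker (f ^ 1) = LinearMap.ker (f ^ Nat.succ 1) := by
    ext y
    rw [pow_one, LinearMap.mem_ker, LinearMap.mem_ker, pow_succ, pow_one, Module.End.mul_apply]
    refine ⟨fun h => by rw [h, map_zero], fun h => ?_⟩
    rw [happ, happ, sub_eq_zero] at h
    rw [happ, nbMatrix_mulVec_eq_self_of_sq hconn hmn h, sub_self]
  refine le_antisymm (fun y hy => ?_) ((Module.End.genEigenspace _ _).monotone le_top)
  obtain ⟨k, hk⟩ := (Module.End.mem_maxGenEigenspace _ _ _).mp hy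
  rw [Module.End.eigenspace_def, ← hf, ← pow_one f, Module.End.ker_pow_constant hker k,
    LinearMap.mem_ker, pow_add, Module.End.mul_apply, hk, map_zero]

omit [Fintype V] [DecidableEq V] [DecidableRel G.Adj] in
lemma exists_dart_edge_eq (e : G.edgeSet) : ∃ d : G.Dart, d.edge = e := by
  obtain ⟨⟨u, v⟩, h⟩ := e
  exact ⟨⟨(u, v), h⟩, rfl⟩

variable (G) in
/-- An arbitrary orientation of the edges. -/
noncomputable def orient (e : G.edgeSet) : G.Dart := (exists_dart_edge_eq e).choose

omit [Fintype V] [DecidableEq V] [DecidableRel G.Adj] in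
lemma orient_edge (e : G.edgeSet) : (G.orient e).edge = e := (exists_dart_edge_eq e).choose_spec

omit [Fintype V] [DecidableEq V] [DecidableRel G.Adj] in
lemma orient_cases (d : G.Dart) :
    d = G.orient ⟨d.edge, d.edge_mem⟩ ∨ d = (G.orient ⟨d.edge, d.edge_mem⟩).symm :=
  (dart_edge_eq_iff _ _).mp (orient_edge ⟨d.edge, d.edge_mem⟩).symm

lemma sum_dart_eq_sum_orient (F : G.Dart → ℂ) :
    ∑ d, F d = ∑ e : G.edgeSet, (F (G.orient e) + F (G.orient e).symm) := by
  rw [← Finset.sum_fiberwise Finset.univ fun d : G.Dart => (⟨d.edge, d.edge_mem⟩ : G.edgeSet)]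
  refine Finset.sum_congr rfl fun e _ => ?_
  have : (Finset.univ.filter fun d : G.Dart => (⟨d.edge, d.edge_mem⟩ : G.edgeSet) = e) =
      {G.orient e, (G.orient e).symm} := by
    rw [← Dart.edge_fiber, orient_edge]
    ext d
    simp [Subtype.ext_iff]
  rw [this, Finset.sum_pair (Dart.symm_ne _).symm]

variable (G) in
/-- The gradient matrix of `G` for an arbitrary orientation. -/
noncomputable def gradMatrix : Matrix G.edgeSet V ℂ :=
  fun e v => (if (G.orient e).snd = v then 1 else 0) - if (G.orient e).fst = v then 1 else 0

omit [DecidableRel G.Adj] in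
lemma gradMatrix_mulVec_apply (g : V → ℂ) (e : G.edgeSet) :
    (G.gradMatrix *ᵥ g) e = g (G.orient e).snd - g (G.orient e).fst := by
  simp [gradMatrix, mulVec, dotProduct, sub_mul, Finset.sum_sub_distrib]

omit [DecidableRel G.Adj] in
lemma rank_gradMatrix (hconn : G.Connected) : G.gradMatrix.rank + 1 = Fintype.card V := by
  have := hconn.nonempty
  have hker : LinearMap.ker G.gradMatrix.mulVecLin = Submodule.span ℂ {fun _ => (1 : ℂ)} := by
    ext g
    rw [LinearMap.mem_ker, mulVecLin_apply, Submodule.mem_span_singleton]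
    constructor
    · intro h
      have hconst := hconn.eq_of_forall_adj (g := g) fun d => by
        have he := congrFun h ⟨d.edge, d.edge_mem⟩
        rw [gradMatrix_mulVec_apply, Pi.zero_apply, sub_eq_zero] at he
        rcases orient_cases d with hd | hd <;> rw [hd]
        · exact he.symm
        · exact he
      exact ⟨g (Classical.arbitrary V), by ext v; simp [hconst v (Classical.arbitrary V)]⟩
    · rintro ⟨c, rfl⟩
      ext e
      simp [gradMatrix_mulVec_apply]
  have h := G.gradMatrix.mulVecLin.finrank_range_add_finrank_ker
  rw [hker, finrank_span_singleton, Module.finrank_fintype_fun_eq_card] at h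
  · exact h
  · exact fun h0 => one_ne_zero (congrFun h0 (Classical.arbitrary V))

variable (G) in
/-- The antisymmetric function on darts with prescribed values on the oriented edges. -/
noncomputable def antisymmExtend : (G.edgeSet → ℂ) →ₗ[ℂ] (G.Dart → ℂ) where
  toFun f d := (if G.orient ⟨d.edge, d.edge_mem⟩ = d then 1 else -1) * f ⟨d.edge, d.edge_mem⟩
  map_add' f g := by ext d; simp [mul_add]
  map_smul' c f := by ext d; simp

omit [Fintype V] [DecidableRel G.Adj] in
lemma antisymmExtend_orient (f : G.edgeSet → ℂ) (e : G.edgeSet) :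
    G.antisymmExtend f (G.orient e) = f e := by
  have : (⟨(G.orient e).edge, (G.orient e).edge_mem⟩ : G.edgeSet) = e :=
    Subtype.ext (orient_edge e)
  simp [antisymmExtend, this]

omit [Fintype V] [DecidableRel G.Adj] in
lemma antisymmExtend_orient_symm (f : G.edgeSet → ℂ) (e : G.edgeSet) :
    G.antisymmExtend f (G.orient e).symm = -f e := by
  have : (⟨(G.orient e).edge, (G.orient e).edge_mem⟩ : G.edgeSet) = e :=
    Subtype.ext (orient_edge e)
  simp [antisymmExtend, this, (Dart.symm_ne (G.orient e)).symm]

omit [Fintype V] [DecidableRel G.Adj] in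
lemma antisymmExtend_injective : Function.Injective G.antisymmExtend := fun f g h => by
  ext e
  rw [← antisymmExtend_orient f, h, antisymmExtend_orient]

omit [Fintype V] [DecidableRel G.Adj] in
lemma antisymmExtend_symm (f : G.edgeSet → ℂ) (d : G.Dart) :
    G.antisymmExtend f d.symm = -G.antisymmExtend f d := by
  rcases orient_cases d with hd | hd <;> rw [hd] <;>
    simp [antisymmExtend_orient, antisymmExtend_orient_symm]

omit [Fintype V] [DecidableRel G.Adj] in
lemma antisymmExtend_comp_orient {x : G.Dart → ℂ} (hx : ∀ d, x d.symm = -x d) :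
    G.antisymmExtend (x ∘ G.orient) = x := by
  ext d
  rcases orient_cases d with hd | hd <;> rw [hd] <;>
    simp [antisymmExtend_orient, antisymmExtend_orient_symm, hx]

lemma inflow_antisymmExtend (f : G.edgeSet → ℂ) :
    G.inflow (G.antisymmExtend f) = G.gradMatrixᵀ *ᵥ f := by
  ext v
  rw [inflow, sum_dart_eq_sum_orient]
  refine Finset.sum_congr rfl fun e _ => ?_
  rw [antisymmExtend_orient, antisymmExtend_orient_symm]
  change _ + (if (G.orient e).fst = v then _ else _) = _
  simp only [transpose_apply, gradMatrix]
  split_ifs <;> ring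

lemma eigenspace_nbMatrix_one (hconn : G.Connected)
    (hmn : Fintype.card V < G.edgeFinset.card) :
    Module.End.eigenspace (toLin' (nbMatrix G)) 1 =
      (LinearMap.ker G.gradMatrixᵀ.mulVecLin).map G.antisymmExtend := by
  ext x
  rw [Module.End.mem_eigenspace_iff, one_smul, toLin'_apply,
    nbMatrix_mulVec_eq_self_iff hconn hmn, Submodule.mem_map]
  constructor
  · rintro ⟨hanti, hin⟩
    have hx := antisymmExtend_comp_orient hanti
    refine ⟨x ∘ G.orient, ?_, hx⟩
    rw [LinearMap.mem_ker, mulVecLin_apply, ← inflow_antisymmExtend, hx]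
    exact funext hin
  · rintro ⟨f, hf, rfl⟩
    rw [LinearMap.mem_ker, mulVecLin_apply, ← inflow_antisymmExtend] at hf
    exact ⟨antisymmExtend_symm f, congrFun hf⟩

lemma finrank_eigenspace_nbMatrix_one (hconn : G.Connected)
    (hmn : Fintype.card V < G.edgeFinset.card) :
    Module.finrank ℂ (Module.End.eigenspace (toLin' (nbMatrix G)) 1) =
      G.edgeFinset.card - Fintype.card V + 1 := by
  rw [eigenspace_nbMatrix_one hconn hmn,
    ← (Submodule.equivMapOfInjective _ antisymmExtend_injective _).finrank_eq]
  have h := G.gradMatrixᵀ.mulVecLin.finrank_range_add_finrank_ker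
  rw [Module.finrank_fintype_fun_eq_card, ← edgeFinset_card] at h
  change G.gradMatrixᵀ.rank + _ = _ at h
  rw [rank_transpose] at h
  have := rank_gradMatrix hconn
  lia

end SimpleGraph

/-- For a connected graph with minimum degree ≥ 2 and more edges than nodes
(at least two independent cycles), the algebraic multiplicity of the
non-backtracking eigenvalue 1 is exactly m − n + 1. -/
theorem am_one_eq {V : Type} [Fintype V] [DecidableEq V]
    (G : SimpleGraph V) [DecidableRel G.Adj]
    (hconn : G.Connected) (hmin : ∀ x : V, 2 ≤ G.degree x)
    (hmn : Fintype.card V < G.edgeFinset.card) :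
    (nbMatrix G).charpoly.rootMultiplicity 1 =
      G.edgeFinset.card - Fintype.card V + 1 := by
  rw [← Matrix.charpoly_toLin', ← LinearMap.finrank_maxGenEigenspace_eq,
    maxGenEigenspace_nbMatrix_one hconn hmn, finrank_eigenspace_nbMatrix_one hconn hmn]
end

section
/- Let G be a connected graph with minimum degree at least 2 and m > n. Then the algebraic multiplicity of λ = −1 as a non-backtracking eigenvalue equals m − n + 1 if G is bipartite, and m − n otherwise. -/
open SimpleGraph Matrix

namespace SimpleGraph

section Incidence

variable {V : Type*} [Fintype V] [DecidableEq V] (G : SimpleGraph V) [DecidableRel G.Adj]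
  (R : Type*) [CommRing R]

/-- The incidence matrix between vertices and the tails of darts. -/
def tailMatrix : Matrix V G.Dart R := Matrix.of fun v d => if d.fst = v then 1 else 0

/-- The incidence matrix between vertices and the heads of darts. -/
def headMatrix : Matrix V G.Dart R := Matrix.of fun v d => if d.snd = v then 1 else 0

/-- The permutation matrix of dart reversal. -/
def dartRevMatrix : Matrix G.Dart G.Dart R := Matrix.of fun d e => if d = e.symm then 1 else 0

theorem tailMatrix_mul_dartRevMatrix :
    G.tailMatrix R * G.dartRevMatrix R = G.headMatrix R := by
  ext v e
  simp [tailMatrix, headMatrix, dartRevMatrix, Matrix.mul_apply]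

theorem headMatrix_mul_dartRevMatrix :
    G.headMatrix R * G.dartRevMatrix R = G.tailMatrix R := by
  ext v e
  simp [tailMatrix, headMatrix, dartRevMatrix, Matrix.mul_apply]

theorem dartRevMatrix_mul_self : G.dartRevMatrix R * G.dartRevMatrix R = 1 := by
  ext d e
  simp [dartRevMatrix, Matrix.mul_apply, Matrix.one_apply]

omit [Fintype V] [DecidableRel G.Adj] in
theorem transpose_dartRevMatrix : (G.dartRevMatrix R)ᵀ = G.dartRevMatrix R := by
  ext d e
  have : e = d.symm ↔ d = e.symm :=
    ⟨fun h => by rw [h, Dart.symm_symm], fun h => by rw [h, Dart.symm_symm]⟩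
  simp [dartRevMatrix, this]

theorem tailMatrix_mul_transpose :
    G.tailMatrix R * (G.tailMatrix R)ᵀ = G.degMatrix R := by
  ext v w
  rw [Matrix.mul_apply, degMatrix, Matrix.diagonal_apply]
  split_ifs with h
  · subst h
    simp [tailMatrix, ← ite_and, ← G.dart_fst_fiber_card_eq_degree v]
  · refine Finset.sum_eq_zero fun d _ => ?_
    by_cases hd : d.fst = v
    · simp [tailMatrix, hd, h]
    · simp [tailMatrix, hd]

theorem headMatrix_mul_transpose :
    G.headMatrix R * (G.headMatrix R)ᵀ = G.degMatrix R := by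
  rw [← G.tailMatrix_mul_dartRevMatrix R, Matrix.transpose_mul, transpose_dartRevMatrix,
    Matrix.mul_assoc, ← Matrix.mul_assoc (G.dartRevMatrix R), dartRevMatrix_mul_self,
    Matrix.one_mul, tailMatrix_mul_transpose]

theorem headMatrix_mul_transpose_tailMatrix :
    G.headMatrix R * (G.tailMatrix R)ᵀ = G.adjMatrix R := by
  ext v w
  rw [Matrix.mul_apply, adjMatrix_apply]
  split_ifs with h
  · rw [Finset.sum_eq_single (⟨(w, v), h.symm⟩ : G.Dart)]
    · simp [headMatrix, tailMatrix]
    · intro d _ hd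
      by_cases h₁ : d.snd = v
      · have h₂ : d.fst ≠ w := fun h₂ => hd (Dart.ext _ _ (Prod.ext h₂ h₁))
        simp [tailMatrix, h₂]
      · simp [headMatrix, h₁]
    · simp
  · refine Finset.sum_eq_zero fun d _ => ?_
    by_cases h₁ : d.snd = v
    · have h₂ : d.fst ≠ w := fun h₂ => h (h₁ ▸ h₂ ▸ d.adj.symm)
      simp [tailMatrix, h₂]
    · simp [headMatrix, h₁]

theorem tailMatrix_mul_transpose_headMatrix :
    G.tailMatrix R * (G.headMatrix R)ᵀ = G.adjMatrix R := by
  rw [← transpose_adjMatrix (α := R) (G := G), ← headMatrix_mul_transpose_tailMatrix, Matrix.transpose_mul,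
    Matrix.transpose_transpose]

variable {R}

theorem det_smul_one_sub_dartRevMatrix_sq (t : R) :
    (t • (1 : Matrix G.Dart G.Dart R) - G.dartRevMatrix R).det ^ 2 =
      (t ^ 2 - 1) ^ Fintype.card G.Dart := by
  let s : G.Dart → R :=
    fun d => if Fintype.equivFin V d.fst < Fintype.equivFin V d.snd then 1 else -1
  have hs (d : G.Dart) : s d * s d = 1 := by
    simp only [s]
    split_ifs <;> simp
  have hs' (d : G.Dart) : s d.symm = -s d := by
    have hne : Fintype.equivFin V d.fst ≠ Fintype.equivFin V d.snd :=
      (Fintype.equivFin V).injective.ne d.fst_ne_snd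
    rcases hne.lt_or_gt with h | h <;> simp [s, h, h.not_gt]
  have hss : Matrix.diagonal s * Matrix.diagonal s = 1 := by
    simp [Matrix.diagonal_mul_diagonal, hs]
  have hconj : Matrix.diagonal s * (t • (1 : Matrix G.Dart G.Dart R) - G.dartRevMatrix R) *
      Matrix.diagonal s = t • (1 : Matrix G.Dart G.Dart R) + G.dartRevMatrix R := by
    ext d e
    rw [Matrix.mul_diagonal, Matrix.diagonal_mul]
    by_cases hde : d = e
    · subst hde
      have : d ≠ d.symm := d.symm_ne.symm
      simp [dartRevMatrix, this]
      linear_combination t * hs d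
    · by_cases h : d = e.symm
      · subst h
        simp [dartRevMatrix, hs', hde, hs]
      · simp [dartRevMatrix, h, hde]
  have hdet := congrArg Matrix.det hss
  rw [Matrix.det_mul, Matrix.det_one] at hdet
  have hconj_det := congrArg Matrix.det hconj
  rw [Matrix.det_mul, Matrix.det_mul] at hconj_det
  have hprod : (t • (1 : Matrix G.Dart G.Dart R) - G.dartRevMatrix R) *
      (t • (1 : Matrix G.Dart G.Dart R) + G.dartRevMatrix R) = (t ^ 2 - 1) • 1 := by
    simp only [sub_mul, mul_add, Matrix.smul_mul, Matrix.mul_smul, Matrix.one_mul,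
      Matrix.mul_one, dartRevMatrix_mul_self]
    module
  have hprod_det := congrArg Matrix.det hprod
  rw [Matrix.det_mul, Matrix.det_smul, Matrix.det_one, mul_one] at hprod_det
  rw [← hprod_det, ← hconj_det]
  linear_combination
    -(t • (1 : Matrix G.Dart G.Dart R) - G.dartRevMatrix R).det ^ 2 * hdet

/-- The vertex matrix `(t² - 1) I - t A + D` of the Ihara determinant formula. -/
def iharaMatrix (t : R) : Matrix V V R :=
  (t ^ 2 - 1) • 1 - t • G.adjMatrix R + G.degMatrix R

/-- The Ihara determinant formula, in a division-free form. -/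
theorem pow_mul_det_dartRevMatrix_mul_det (t : R) :
    (t ^ 2 - 1) ^ Fintype.card V *
      ((t • (1 : Matrix G.Dart G.Dart R) - G.dartRevMatrix R).det *
        (t • (1 : Matrix G.Dart G.Dart R) -
          ((G.tailMatrix R)ᵀ * G.headMatrix R - G.dartRevMatrix R)).det) =
      (t ^ 2 - 1) ^ Fintype.card G.Dart * (G.iharaMatrix t).det := by
  have h := congrArg (Polynomial.eval (t ^ 2 - 1))
    (Matrix.charpoly_mul_comm'
      ((t • (1 : Matrix G.Dart G.Dart R) - G.dartRevMatrix R) * (G.tailMatrix R)ᵀ)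
      (G.headMatrix R))
  simp only [Polynomial.eval_mul, Polynomial.eval_pow, Polynomial.eval_X,
    Matrix.eval_charpoly] at h
  rw [← Matrix.det_mul]
  convert h using 3
  · simp only [Matrix.scalar_apply, ← Matrix.smul_one_eq_diagonal, Matrix.sub_mul, Matrix.mul_sub,
      Matrix.smul_mul, Matrix.mul_smul, Matrix.one_mul, Matrix.mul_one,
      dartRevMatrix_mul_self, Matrix.mul_assoc]
    module
  · simp only [Matrix.scalar_apply, ← Matrix.smul_one_eq_diagonal, Matrix.sub_mul, Matrix.mul_sub,
      Matrix.smul_mul, Matrix.mul_smul, Matrix.one_mul, ← Matrix.mul_assoc,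
      headMatrix_mul_dartRevMatrix, tailMatrix_mul_transpose,
      headMatrix_mul_transpose_tailMatrix, iharaMatrix]
    module

end Incidence

theorem Connected.eq_of_forall_adj_eq {V α : Type*} {G : SimpleGraph V} (hG : G.Connected) {f : V → α}
    (hf : ∀ v w, G.Adj v w → f v = f w) (v w : V) : f v = f w := by
  obtain ⟨p⟩ := hG.preconnected v w
  induction p with
  | nil => rfl
  | cons h _ ih => exact (hf _ _ h).trans ih

/-- The sign vector of a two-colouring. -/
theorem Colorable.exists_sign {V : Type*} {G : SimpleGraph V} (hG : G.Colorable 2) :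
    ∃ s : V → ℤ, (∀ v, s v * s v = 1) ∧ ∀ v w, G.Adj v w → s w = -s v := by
  obtain ⟨c⟩ := hG
  refine ⟨fun v => if c v = 0 then 1 else -1, fun v => by dsimp only; split_ifs <;> simp, ?_⟩
  intro v w h
  have := c.valid h
  dsimp only
  split_ifs <;> omega

section Signless

variable {V : Type*} [Fintype V] [DecidableEq V] {G : SimpleGraph V} [DecidableRel G.Adj]

open scoped ComplexOrder in
/-- A vector in the kernel of the signless Laplacian changes sign along every edge. -/
theorem eq_neg_of_signless_mulVec_eq_zero {x : V → ℂ}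
    (hx : (G.degMatrix ℂ + G.adjMatrix ℂ) *ᵥ x = 0) {v w : V} (h : G.Adj v w) :
    x w = -x v := by
  have hstar : (G.tailMatrix ℂ + G.headMatrix ℂ)ᴴ = (G.tailMatrix ℂ + G.headMatrix ℂ)ᵀ := by
    ext d v
    simp only [tailMatrix, headMatrix, Matrix.conjTranspose_apply, Matrix.transpose_apply,
      Matrix.add_apply, Matrix.of_apply]
    split_ifs <;> simp
  have hN : (G.tailMatrix ℂ + G.headMatrix ℂ) * (G.tailMatrix ℂ + G.headMatrix ℂ)ᴴ =
      (2 : ℂ) • (G.degMatrix ℂ + G.adjMatrix ℂ) := by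
    rw [hstar, Matrix.transpose_add, Matrix.add_mul, Matrix.mul_add, Matrix.mul_add,
      tailMatrix_mul_transpose,
      headMatrix_mul_transpose, tailMatrix_mul_transpose_headMatrix,
      headMatrix_mul_transpose_tailMatrix]
    module
  have hker := (Matrix.self_mul_conjTranspose_mulVec_eq_zero
    (G.tailMatrix ℂ + G.headMatrix ℂ) x).1 (by rw [hN, Matrix.smul_mulVec, hx, smul_zero])
  have hd := congrFun hker ⟨(v, w), h⟩
  rw [hstar] at hd
  simp [tailMatrix, headMatrix, Matrix.mulVec, dotProduct, add_mul, Finset.sum_add_distrib] at hd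
  linear_combination hd

theorem colorable_two_of_det_signless_eq_zero (hG : G.Connected)
    (h : (G.degMatrix ℂ + G.adjMatrix ℂ).det = 0) : G.Colorable 2 := by
  obtain ⟨x, hx0, hx⟩ := Matrix.exists_mulVec_eq_zero_iff.2 h
  obtain ⟨a, ha⟩ := Function.ne_iff.1 hx0
  have hsq (v : V) : x v ^ 2 = x a ^ 2 :=
    hG.eq_of_forall_adj_eq (f := fun v => x v ^ 2)
      (fun v w hvw => by rw [eq_neg_of_signless_mulVec_eq_zero hx hvw, neg_sq]) v a
  classical
  refine (Coloring.mk (fun v => decide (x v = x a)) ?_ : G.Coloring Bool).colorable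
  intro v w hvw heq
  have hw := eq_neg_of_signless_mulVec_eq_zero hx hvw
  have ha' : x a ≠ 0 := ha
  rw [decide_eq_decide] at heq
  rcases sq_eq_sq_iff_eq_or_eq_neg.1 (hsq v) with hv | hv
  · have := heq.1 hv
    rw [hw, hv] at this
    exact ha' (self_eq_neg.1 this.symm)
  · have := heq.2 (by rw [hw, hv, neg_neg])
    rw [hv] at this
    exact ha' (self_eq_neg.1 this.symm)

omit [DecidableEq V] in
theorem adjMatrix_mulVec_sign (R : Type*) [CommRing R] {s : V → ℤ}
    (hadj : ∀ v w, G.Adj v w → s w = -s v) (v : V) :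
    (G.adjMatrix R *ᵥ fun w => (s w : R)) v = -(G.degree v * s v) := by
  rw [adjMatrix_mulVec_apply, Finset.sum_congr rfl (g := fun _ => -(s v : R))]
  · simp
  · intro w hw
    rw [hadj v w ((G.mem_neighborFinset v w).1 hw)]
    push_cast
    rfl

theorem iharaMatrix_mulVec_sign {R : Type*} [CommRing R] (t : R) {s : V → ℤ}
    (hadj : ∀ v w, G.Adj v w → s w = -s v) :
    (G.iharaMatrix t *ᵥ fun w => (s w : R)) =
      (t + 1) • fun v => (t - 1 + G.degree v) * (s v : R) := by
  ext v
  simp only [iharaMatrix, Matrix.add_mulVec, Matrix.sub_mulVec, Matrix.smul_mulVec,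
    Matrix.one_mulVec, Pi.add_apply, Pi.sub_apply, Pi.smul_apply, adjMatrix_mulVec_sign R hadj,
    degMatrix_mulVec_apply, smul_eq_mul]
  ring

theorem det_updateCol_signless_ne_zero (hG : G.Connected)
    (hmn : Fintype.card V < G.edgeFinset.card) {s : V → ℤ} (hs : ∀ v, s v * s v = 1)
    (hadj : ∀ v w, G.Adj v w → s w = -s v) (a : V) :
    ((G.degMatrix ℂ + G.adjMatrix ℂ).updateCol a
      fun v => (G.degree v - 2) * (s v : ℂ)).det ≠ 0 := by
  intro h
  obtain ⟨y, hy0, hy⟩ := Matrix.exists_mulVec_eq_zero_iff.2 h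
  set N := G.degMatrix ℂ + G.adjMatrix ℂ with hN
  set u : V → ℂ := fun v => (G.degree v - 2) * (s v : ℂ) with hu
  set z := Function.update y a 0 with hz
  have hsplit : N *ᵥ z + y a • u = 0 := by
    rw [← hy]
    ext v
    have (j : V) : N.updateCol a u v j * y j = N v j * z j + if j = a then y a * u v else 0 := by
      by_cases hj : j = a
      · subst hj
        simp [hz, mul_comm]
      · simp [hz, hj]
    simp [Matrix.mulVec, dotProduct, this, Finset.sum_add_distrib]
  have hNs : (fun v => (s v : ℂ)) ᵥ* N = 0 := by
    have hNt : Nᵀ = N := by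
      rw [hN, Matrix.transpose_add, transpose_adjMatrix, degMatrix, Matrix.diagonal_transpose]
    rw [← hNt, Matrix.vecMul_transpose]
    ext v
    rw [hN, Matrix.add_mulVec, Pi.add_apply, adjMatrix_mulVec_sign ℂ hadj,
      degMatrix_mulVec_apply, add_neg_cancel, Pi.zero_apply]
  have hsu : (fun v => (s v : ℂ)) ⬝ᵥ u = 2 * G.edgeFinset.card - 2 * Fintype.card V := by
    have (v : V) : (s v : ℂ) * ((G.degree v - 2) * s v) = G.degree v - 2 := by
      have : (s v : ℂ) * s v = 1 := by exact_mod_cast hs v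
      linear_combination ((G.degree v : ℂ) - 2) * this
    have hdeg : (∑ v, (G.degree v : ℂ)) = 2 * G.edgeFinset.card := by
      exact_mod_cast G.sum_degrees_eq_twice_card_edges
    simp only [dotProduct, hu, this, Finset.sum_sub_distrib, hdeg]
    simp [mul_comm]
  have hya : y a = 0 := by
    have := congrArg (fun x => (fun v => (s v : ℂ)) ⬝ᵥ x) hsplit
    simp only [dotProduct_add, Matrix.dotProduct_mulVec, hNs, zero_dotProduct, dotProduct_smul,
      hsu, dotProduct_zero, zero_add, smul_eq_mul] at this
    refine (mul_eq_zero.1 this).resolve_right fun h0 => hmn.ne ?_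
    have : (Fintype.card V : ℂ) = G.edgeFinset.card := by linear_combination -h0 / 2
    exact_mod_cast this
  rw [hya, zero_smul, add_zero] at hsplit
  apply hy0
  ext v
  have hsq : z v ^ 2 = z a ^ 2 :=
    hG.eq_of_forall_adj_eq (f := fun v => z v ^ 2)
      (fun v w hvw => by rw [eq_neg_of_signless_mulVec_eq_zero hsplit hvw, neg_sq]) v a
  have hza : z a = 0 := by simp [hz]
  have hzv : z v = 0 := by simpa [hza] using hsq
  by_cases hv : v = a
  · rw [hv, hya, Pi.zero_apply]
  · simpa [hz, hv] using hzv

theorem map_iharaMatrix {R S : Type*} [CommRing R] [CommRing S] (f : R →+* S) (t : R) :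
    f.mapMatrix (G.iharaMatrix t) = G.iharaMatrix (f t) := by
  ext v w
  by_cases hvw : v = w
  · subst hvw
    simp [iharaMatrix, degMatrix]
  · simp [iharaMatrix, degMatrix, hvw, apply_ite f]

theorem iharaMatrix_neg_one (R : Type*) [CommRing R] :
    G.iharaMatrix (-1 : R) = G.degMatrix R + G.adjMatrix R := by
  simp [iharaMatrix, add_comm]

open Polynomial

theorem rootMultiplicity_det_iharaMatrix_of_not_colorable (hG : G.Connected)
    (h : ¬ G.Colorable 2) :
    (G.iharaMatrix (X : ℂ[X])).det ≠ 0 ∧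
      (G.iharaMatrix (X : ℂ[X])).det.rootMultiplicity (-1) = 0 := by
  have heval : (G.iharaMatrix (X : ℂ[X])).det.eval (-1) ≠ 0 := by
    rw [← coe_evalRingHom, RingHom.map_det, map_iharaMatrix, coe_evalRingHom, eval_X,
      iharaMatrix_neg_one]
    exact fun h0 => h (colorable_two_of_det_signless_eq_zero hG h0)
  exact ⟨fun h0 => heval (by rw [h0, eval_zero]), rootMultiplicity_eq_zero heval⟩

theorem rootMultiplicity_det_iharaMatrix_of_colorable (hG : G.Connected)
    (hmn : Fintype.card V < G.edgeFinset.card) (h : G.Colorable 2) :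
    (G.iharaMatrix (X : ℂ[X])).det ≠ 0 ∧
      (G.iharaMatrix (X : ℂ[X])).det.rootMultiplicity (-1) = 1 := by
  obtain ⟨s, hs, hadj⟩ := h.exists_sign
  obtain ⟨a⟩ := hG.nonempty
  set w : V → ℂ[X] := fun v => (X - 1 + (G.degree v : ℂ[X])) * (s v : ℂ[X]) with hw
  set r := ((G.iharaMatrix (X : ℂ[X])).updateCol a w).det with hr
  have hreval : r.eval (-1) ≠ 0 := by
    have hmap : (evalRingHom (-1 : ℂ)) ∘ w = fun v => (G.degree v - 2) * (s v : ℂ) := by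
      ext v
      simp [hw]
      exact Or.inl (by ring)
    rw [hr, ← coe_evalRingHom, RingHom.map_det, RingHom.mapMatrix_apply, Matrix.map_updateCol,
      ← RingHom.mapMatrix_apply, map_iharaMatrix, hmap, coe_evalRingHom, eval_X,
      iharaMatrix_neg_one]
    exact det_updateCol_signless_ne_zero hG hmn hs hadj a
  have hfactor : (G.iharaMatrix (X : ℂ[X])).det * (s a : ℂ[X]) = (X - C (-1)) * r := by
    have h1 := congrFun (congrArg (Matrix.cramer (G.iharaMatrix (X : ℂ[X])))
      (iharaMatrix_mulVec_sign (X : ℂ[X]) hadj)) a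
    rw [map_smul, Matrix.cramer_eq_adjugate_mulVec, Matrix.mulVec_mulVec, Matrix.adjugate_mul,
      Matrix.smul_mulVec, Matrix.one_mulVec, Pi.smul_apply, Pi.smul_apply,
      Matrix.cramer_apply] at h1
    simpa using h1
  have hdet : (G.iharaMatrix (X : ℂ[X])).det = (X - C (-1)) * (r * (s a : ℂ[X])) := by
    have hsa : (s a : ℂ[X]) * s a = 1 := by exact_mod_cast hs a
    linear_combination (s a : ℂ[X]) * hfactor - (G.iharaMatrix (X : ℂ[X])).det * hsa
  have heval : (r * (s a : ℂ[X])).eval (-1) ≠ 0 := by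
    have hsa : (s a : ℂ) ≠ 0 := by
      have := hs a
      exact_mod_cast left_ne_zero_of_mul_eq_one this
    simpa [hsa] using hreval
  have hne : (X - C (-1)) * (r * (s a : ℂ[X])) ≠ 0 :=
    mul_ne_zero (X_sub_C_ne_zero _) fun h0 => heval (by rw [h0, eval_zero])
  rw [hdet]
  refine ⟨hne, ?_⟩
  rw [rootMultiplicity_mul hne, rootMultiplicity_X_sub_C_self, rootMultiplicity_eq_zero heval]

end Signless

end SimpleGraph

open Polynomial in
theorem charpoly_nbMatrix {V : Type} [Fintype V] [DecidableEq V] (G : SimpleGraph V)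
    [DecidableRel G.Adj] :
    (nbMatrix G).charpoly = ((X : ℂ[X]) • (1 : Matrix G.Dart G.Dart ℂ[X]) -
      ((G.tailMatrix ℂ[X])ᵀ * G.headMatrix ℂ[X] - G.dartRevMatrix ℂ[X])).det := by
  rw [Matrix.charpoly, Matrix.charmatrix, Matrix.scalar_apply, ← Matrix.smul_one_eq_diagonal]
  congr 2
  ext1 d e
  have hrev : d = e.symm ↔ d.fst = e.snd ∧ d.snd = e.fst := by
    simp [Dart.ext_iff, Prod.ext_iff]
  by_cases h₁ : e.snd = d.fst
  · by_cases h₂ : e.fst = d.snd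
    · simp [nbMatrix, tailMatrix, headMatrix, dartRevMatrix, Matrix.mul_apply, hrev, h₁, h₂]
    · simp [nbMatrix, tailMatrix, headMatrix, dartRevMatrix, Matrix.mul_apply, hrev, h₁, h₂,
        Ne.symm h₂]
  · simp [nbMatrix, tailMatrix, headMatrix, dartRevMatrix, Matrix.mul_apply, hrev, h₁,
      Ne.symm h₁]

open Polynomial in
theorem card_add_rootMultiplicity_charpoly_nbMatrix {V : Type} [Fintype V] [DecidableEq V]
    (G : SimpleGraph V) [DecidableRel G.Adj] (hq : (G.iharaMatrix (X : ℂ[X])).det ≠ 0) :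
    Fintype.card V + (nbMatrix G).charpoly.rootMultiplicity (-1) =
      G.edgeFinset.card + (G.iharaMatrix (X : ℂ[X])).det.rootMultiplicity (-1) := by
  have hihara := G.pow_mul_det_dartRevMatrix_mul_det (X : ℂ[X])
  have hsq := G.det_smul_one_sub_dartRevMatrix_sq (X : ℂ[X])
  rw [← charpoly_nbMatrix] at hihara
  set E := ((X : ℂ[X]) • (1 : Matrix G.Dart G.Dart ℂ[X]) - G.dartRevMatrix ℂ[X]).det
  have hfactor : (X ^ 2 - 1 : ℂ[X]) = (X - C (-1)) * (X - C 1) := by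
    simp
    ring
  have hc : (X ^ 2 - 1 : ℂ[X]) ≠ 0 := by
    rw [hfactor]
    exact mul_ne_zero (X_sub_C_ne_zero _) (X_sub_C_ne_zero _)
  have hcmult : (X ^ 2 - 1 : ℂ[X]).rootMultiplicity (-1) = 1 := by
    have hroot : ¬ (X - C 1 : ℂ[X]).IsRoot (-1) := by
      norm_num [IsRoot.def]
    rw [hfactor, rootMultiplicity_mul (hfactor ▸ hc), rootMultiplicity_X_sub_C_self,
      rootMultiplicity_eq_zero hroot]
  have hcpow (k : ℕ) : ((X ^ 2 - 1 : ℂ[X]) ^ k).rootMultiplicity (-1) = k := by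
    rw [← count_roots, roots_pow, Multiset.count_nsmul, count_roots, hcmult, mul_one]
  have hE : E ≠ 0 := fun h0 => pow_ne_zero _ hc (by rw [← hsq, h0, zero_pow two_ne_zero])
  have hEmult := congrArg (rootMultiplicity (-1)) hsq
  rw [hcpow, pow_two, rootMultiplicity_mul (mul_ne_zero hE hE),
    G.dart_card_eq_twice_card_edges] at hEmult
  have hP := (Matrix.charpoly_monic (nbMatrix G)).ne_zero
  have hmult := congrArg (rootMultiplicity (-1)) hihara
  rw [rootMultiplicity_mul (mul_ne_zero (pow_ne_zero _ hc) (mul_ne_zero hE hP)),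
    rootMultiplicity_mul (mul_ne_zero hE hP), rootMultiplicity_mul (mul_ne_zero
    (pow_ne_zero _ hc) hq), hcpow, hcpow, G.dart_card_eq_twice_card_edges] at hmult
  omega

/-- For a connected graph with minimum degree ≥ 2 and m > n, the algebraic multiplicity
of the non-backtracking eigenvalue −1 is m − n + 1 if G is bipartite and m − n otherwise. -/
theorem am_neg_one_eq {V : Type} [Fintype V] [DecidableEq V]
    (G : SimpleGraph V) [DecidableRel G.Adj]
    (hconn : G.Connected) (hmin : ∀ x : V, 2 ≤ G.degree x)
    (hmn : Fintype.card V < G.edgeFinset.card) :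
    (G.Colorable 2 →
      (nbMatrix G).charpoly.rootMultiplicity (-1) =
        G.edgeFinset.card - Fintype.card V + 1) ∧
    (¬ G.Colorable 2 →
      (nbMatrix G).charpoly.rootMultiplicity (-1) =
        G.edgeFinset.card - Fintype.card V) := by
  constructor
  · intro h
    obtain ⟨hq, hmult⟩ := rootMultiplicity_det_iharaMatrix_of_colorable hconn hmn h
    have := card_add_rootMultiplicity_charpoly_nbMatrix G hq
    omega
  · intro h
    obtain ⟨hq, hmult⟩ := rootMultiplicity_det_iharaMatrix_of_not_colorable hconn h
    have := card_add_rootMultiplicity_charpoly_nbMatrix G hq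
    omega
end
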